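/- arXiv:1711.05406 — 5 statements merged into one kernel-verified Lean document; each statement's English description precedes it below -/
import Mathlib

section
/- (Weak duality for the first linear FR-TSVM problem.) Let (w, b, ξ) be feasible for the primal problem, i.e., -(X₋w + e₋b) + ξ ≥ e₋ and ξ ≥ 0 componentwise, and let α ∈ ℝ^{l₋} satisfy 0 ≤ α ≤ c₃s₋ componentwise. Then ⟨e₋, α⟩ - (1/2)αᵀH₋M⁻¹H₋ᵀα ≤ (1/2)c₁‖w‖² + (1/2)‖X₊w + e₊b‖² + c₃⟨s₋, ξ⟩. -/
open Matrix

/-- Fenchel–Young inequality for the quadratic form of a positive definite real matrix. -/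
theorem Matrix.PosDef.neg_dotProduct_le_half_add_half_inv {ι : Type*} [Fintype ι] [DecidableEq ι]
    {M : Matrix ι ι ℝ} (hM : M.PosDef) (p z : ι → ℝ) :
    -(p ⬝ᵥ z) ≤ (1 / 2) * (z ⬝ᵥ M *ᵥ z) + (1 / 2) * (p ⬝ᵥ M⁻¹ *ᵥ p) := by
  have hdet : IsUnit M.det := (M.isUnit_iff_isUnit_det).1 hM.isUnit
  have hMv : M *ᵥ (M⁻¹ *ᵥ p) = p := by
    rw [mulVec_mulVec, mul_nonsing_inv _ hdet, one_mulVec]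
  have hsymm : Mᵀ = M := by simpa using hM.isHermitian.eq
  have hcross : (M⁻¹ *ᵥ p) ⬝ᵥ M *ᵥ z = p ⬝ᵥ z := by
    rw [dotProduct_mulVec, ← mulVec_transpose, hsymm, hMv]
  have hnonneg : 0 ≤ (z + M⁻¹ *ᵥ p) ⬝ᵥ M *ᵥ (z + M⁻¹ *ᵥ p) := by
    simpa using hM.posSemidef.dotProduct_mulVec_nonneg (z + M⁻¹ *ᵥ p)
  rw [mulVec_add, hMv, add_dotProduct, dotProduct_add, dotProduct_add, hcross,
    dotProduct_comm z p, dotProduct_comm _ p] at hnonneg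
  linarith

/-- Multiplying `[X, e]` by `(w, b)` gives `X w + b e`. -/
theorem of_snoc_one_mulVec_snoc {n l : ℕ} (X : Matrix (Fin l) (Fin n) ℝ) (w : Fin n → ℝ) (b : ℝ) :
    (Matrix.of fun i => (Fin.snoc (X i) 1 : Fin (n + 1) → ℝ)) *ᵥ (Fin.snoc w b : Fin (n + 1) → ℝ)
      = X *ᵥ w + b • (fun _ : Fin l => (1 : ℝ)) := by
  ext i
  simp [mulVec, dotProduct, Fin.sum_univ_castSucc]

theorem snoc_dotProduct_gram_mulVec_snoc {n l : ℕ} (X : Matrix (Fin l) (Fin n) ℝ) (c : ℝ)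
    (w : Fin n → ℝ) (b : ℝ) :
    (Fin.snoc w b : Fin (n + 1) → ℝ) ⬝ᵥ
      ((Matrix.of fun i => (Fin.snoc (X i) 1 : Fin (n + 1) → ℝ))ᵀ *
          (Matrix.of fun i => (Fin.snoc (X i) 1 : Fin (n + 1) → ℝ)) +
        c • Matrix.diagonal (Fin.snoc (fun _ : Fin n => (1 : ℝ)) 0 : Fin (n + 1) → ℝ)) *ᵥ
          (Fin.snoc w b : Fin (n + 1) → ℝ)
      = (X *ᵥ w + b • (fun _ : Fin l => (1 : ℝ))) ⬝ᵥ (X *ᵥ w + b • (fun _ : Fin l => (1 : ℝ)))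
        + c * (w ⬝ᵥ w) := by
  rw [add_mulVec, dotProduct_add, ← mulVec_mulVec, dotProduct_mulVec, vecMul_transpose,
    of_snoc_one_mulVec_snoc, smul_mulVec, dotProduct_smul, smul_eq_mul]
  congr 2
  simp [dotProduct, mulVec_diagonal, Fin.sum_univ_castSucc]

theorem posDef_gram_add_smul_diagonal {n l : ℕ} (hl : 1 ≤ l) (X : Matrix (Fin l) (Fin n) ℝ)
    {c : ℝ} (hc : 0 < c) :
    ((Matrix.of fun i => (Fin.snoc (X i) 1 : Fin (n + 1) → ℝ))ᵀ *
        (Matrix.of fun i => (Fin.snoc (X i) 1 : Fin (n + 1) → ℝ)) +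
      c • Matrix.diagonal (Fin.snoc (fun _ : Fin n => (1 : ℝ)) 0 : Fin (n + 1) → ℝ)).PosDef := by
  refine PosDef.of_dotProduct_mulVec_pos ?_ fun x hx => ?_
  · simp [IsHermitian, conjTranspose_eq_transpose_of_trivial, transpose_mul]
  · obtain ⟨w, b, rfl⟩ : ∃ (w : Fin n → ℝ) (b : ℝ), x = Fin.snoc w b :=
      ⟨Fin.init x, x (Fin.last n), (Fin.snoc_init_self x).symm⟩
    rw [star_trivial, snoc_dotProduct_gram_mulVec_snoc]
    by_cases hw : w = 0
    · subst hw
      have hb : b ≠ 0 := by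
        rintro rfl
        refine hx (funext fun i => ?_)
        refine Fin.lastCases ?_ (fun j => ?_) i <;> simp
      have hl' : (0 : ℝ) < l := by exact_mod_cast hl
      have : 0 < (l : ℝ) * (b * b) := mul_pos hl' (mul_self_pos.2 hb)
      simpa [dotProduct] using this
    · have hww : 0 < w ⬝ᵥ w := by simpa using dotProduct_star_self_pos_iff.2 hw
      exact add_pos_of_nonneg_of_pos (Finset.sum_nonneg fun i _ => mul_self_nonneg _)
        (mul_pos hc hww)

/-- Weak duality for the first linear FR-TSVM problem: any dual-feasible `α` gives a value of
the dual objective no larger than the primal objective at any primal-feasible `(w, b, ξ)`. -/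
theorem frtsvm_weak_duality {n lp lm : ℕ} (hlp : 1 ≤ lp) (hlm : 1 ≤ lm)
    (Xp : Matrix (Fin lp) (Fin n) ℝ) (Xm : Matrix (Fin lm) (Fin n) ℝ)
    (c₁ c₃ : ℝ) (hc₁ : 0 < c₁) (hc₃ : 0 < c₃)
    (s : Fin lm → ℝ) (hs : ∀ i, 0 < s i)
    (w : Fin n → ℝ) (b : ℝ) (ξ : Fin lm → ℝ)
    (hfeas : ∀ i, -((Xm *ᵥ w) i + b) + ξ i ≥ 1) (hξ : ∀ i, 0 ≤ ξ i)
    (α : Fin lm → ℝ) (hα0 : ∀ i, 0 ≤ α i) (hαc : ∀ i, α i ≤ c₃ * s i) :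
    let Hp : Matrix (Fin lp) (Fin (n + 1)) ℝ := Matrix.of fun i => Fin.snoc (Xp i) 1
    let Hm : Matrix (Fin lm) (Fin (n + 1)) ℝ := Matrix.of fun i => Fin.snoc (Xm i) 1
    let E₁ : Matrix (Fin (n + 1)) (Fin (n + 1)) ℝ :=
      Matrix.diagonal (Fin.snoc (fun _ : Fin n => (1 : ℝ)) 0)
    let M := Hpᵀ * Hp + c₁ • E₁
    (fun _ : Fin lm => (1 : ℝ)) ⬝ᵥ α - (1 / 2) * (α ⬝ᵥ (Hm * M⁻¹ * Hmᵀ) *ᵥ α)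
      ≤ (1 / 2) * c₁ * (w ⬝ᵥ w)
        + (1 / 2) * ((Xp *ᵥ w + b • (fun _ : Fin lp => (1 : ℝ)))
            ⬝ᵥ (Xp *ᵥ w + b • (fun _ : Fin lp => (1 : ℝ))))
        + c₃ * (s ⬝ᵥ ξ) := by
  intro Hp Hm E₁ M
  have hM : M.PosDef := posDef_gram_add_smul_diagonal hlp Xp hc₁
  have hquad := snoc_dotProduct_gram_mulVec_snoc Xp c₁ w b
  have hyoung := hM.neg_dotProduct_le_half_add_half_inv (Hmᵀ *ᵥ α) (Fin.snoc w b)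
  have hHm : (Hmᵀ *ᵥ α) ⬝ᵥ (Fin.snoc w b : Fin (n + 1) → ℝ) = ∑ i, α i * ((Xm *ᵥ w) i + b) := by
    rw [mulVec_transpose, ← dotProduct_mulVec, of_snoc_one_mulVec_snoc]
    simp [dotProduct]
  have hdual : α ⬝ᵥ (Hm * M⁻¹ * Hmᵀ) *ᵥ α = (Hmᵀ *ᵥ α) ⬝ᵥ M⁻¹ *ᵥ (Hmᵀ *ᵥ α) := by
    rw [← mulVec_mulVec, ← mulVec_mulVec, dotProduct_mulVec, mulVec_transpose]
  have hsum : (fun _ : Fin lm => (1 : ℝ)) ⬝ᵥ α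
      ≤ -(∑ i, α i * ((Xm *ᵥ w) i + b)) + c₃ * (s ⬝ᵥ ξ) := by
    rw [dotProduct, dotProduct, Finset.mul_sum, ← Finset.sum_neg_distrib, ← Finset.sum_add_distrib]
    refine Finset.sum_le_sum fun i _ => ?_
    have hfeas_mul := mul_le_mul_of_nonneg_left (hfeas i) (hα0 i)
    have hslack := mul_le_mul_of_nonneg_right (hαc i) (hξ i)
    linarith
  rw [hHm] at hyoung
  rw [hdual]
  linarith
end

section
/- (Theorem 1, first problem: primal recovery from the dual optimum.) Suppose α* maximizes the dual objective ⟨e₋, α⟩ - (1/2)αᵀH₋M⁻¹H₋ᵀα over the box {α ∈ ℝ^{l₋} : 0 ≤ α ≤ c₃s₋}. Define u* = (w*, b*) = -M⁻¹H₋ᵀα* and ξ* ∈ ℝ^{l₋} by ξ*ᵢ = max(0, 1 + (X₋w* + e₋b*)ᵢ). Then (w*, b*, ξ*) is feasible for the primal problem, it minimizes the primal objective over all feasible (w, b, ξ), and the optimal primal value equals the optimal dual value. -/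
open Matrix

/-- Objective of the dual of a box-constrained support vector problem. -/
noncomputable def boxDual {k m : Type*} [Fintype k] [DecidableEq k] [Fintype m]
    (M : Matrix k k ℝ) (H : Matrix m k ℝ) (α : m → ℝ) : ℝ :=
  (fun _ : m => (1 : ℝ)) ⬝ᵥ α - (1 / 2) * (α ⬝ᵥ (H * M⁻¹ * Hᵀ) *ᵥ α)

/-- A linear function dominated by a quadratic one near `0⁺` has nonpositive slope. -/
theorem nonpos_of_forall_mul_le_sq {a b : ℝ}
    (h : ∀ t : ℝ, 0 ≤ t → t ≤ 1 → t * a ≤ t ^ 2 * b) : a ≤ 0 := by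
  by_contra! ha
  have hb : 0 < a + |b| := by positivity
  have ht0 : 0 < a / (2 * (a + |b|)) := by positivity
  have ht1 : a / (2 * (a + |b|)) ≤ 1 := by
    rw [div_le_one (by positivity)]
    linarith [abs_nonneg b]
  have key := h _ ht0.le ht1
  rw [pow_two, mul_assoc] at key
  have key' := le_of_mul_le_mul_left key ht0
  have hle : a / (2 * (a + |b|)) * b ≤ a / (2 * (a + |b|)) * (a + |b|) :=
    mul_le_mul_of_nonneg_left (by linarith [le_abs_self b]) ht0.le
  have heq : a / (2 * (a + |b|)) * (a + |b|) = a / 2 := by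
    field_simp
  linarith

theorem dotProduct_mulVec_comm {k : Type*} [Fintype k] {M : Matrix k k ℝ}
    (hM : Mᵀ = M) (u v : k → ℝ) :
    u ⬝ᵥ M *ᵥ v = v ⬝ᵥ M *ᵥ u := by
  rw [dotProduct_mulVec, ← mulVec_transpose, hM, dotProduct_comm]

section BoxDual

variable {k m : Type*} [Fintype k] [DecidableEq k] [Fintype m]
  {M : Matrix k k ℝ} {H : Matrix m k ℝ}

theorem mulVec_neg_inv_mulVec (hM : M.PosDef) (y : k → ℝ) :
    M *ᵥ (-(M⁻¹ *ᵥ y)) = -y := by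
  rw [mulVec_neg, mulVec_mulVec, mul_nonsing_inv _ ((isUnit_iff_isUnit_det _).1 hM.isUnit),
    one_mulVec]

/-- Completing the square in the dual objective. -/
theorem boxDual_eq (hM : M.PosDef) {α : m → ℝ} {u : k → ℝ}
    (hu : u = -(M⁻¹ *ᵥ (Hᵀ *ᵥ α))) :
    boxDual M H α = (fun _ : m => (1 : ℝ)) ⬝ᵥ α - (1 / 2) * (u ⬝ᵥ M *ᵥ u) := by
  have h : u ⬝ᵥ M *ᵥ u = α ⬝ᵥ (H * M⁻¹ * Hᵀ) *ᵥ α := by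
    subst hu
    rw [mulVec_neg_inv_mulVec hM, neg_dotProduct_neg, dotProduct_comm, ← mulVec_mulVec,
      ← mulVec_mulVec, mulVec_transpose, dotProduct_mulVec α H]
  rw [boxDual, h]

theorem dotProduct_mulVec_eq_neg (hM : M.PosDef) {α : m → ℝ} {u : k → ℝ}
    (hu : u = -(M⁻¹ *ᵥ (Hᵀ *ᵥ α))) (v : k → ℝ) :
    α ⬝ᵥ H *ᵥ v = -(v ⬝ᵥ M *ᵥ u) := by
  rw [hu, mulVec_neg_inv_mulVec hM, dotProduct_neg, neg_neg, dotProduct_mulVec,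
    ← mulVec_transpose, dotProduct_comm]

/-- Weak duality. -/
theorem boxDual_le (hM : M.PosDef) {c α : m → ℝ} (hα : ∀ i, 0 ≤ α i ∧ α i ≤ c i)
    {v : k → ℝ} {ξ : m → ℝ} (hξ : ∀ i, 1 + (H *ᵥ v) i ≤ ξ i ∧ 0 ≤ ξ i) :
    boxDual M H α ≤ (1 / 2) * (v ⬝ᵥ M *ᵥ v) + c ⬝ᵥ ξ := by
  obtain ⟨u, hu⟩ : ∃ u, u = -(M⁻¹ *ᵥ (Hᵀ *ᵥ α)) := ⟨_, rfl⟩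
  have hsymm : Mᵀ = M := by simpa using hM.isHermitian.eq
  have hsq : 0 ≤ (v - u) ⬝ᵥ M *ᵥ (v - u) := by
    simpa using hM.posSemidef.dotProduct_mulVec_nonneg (v - u)
  rw [mulVec_sub, dotProduct_sub, sub_dotProduct, sub_dotProduct,
    dotProduct_mulVec_comm hsymm u v] at hsq
  have hle : (fun _ : m => (1 : ℝ)) ⬝ᵥ α + α ⬝ᵥ H *ᵥ v ≤ c ⬝ᵥ ξ := by
    simp only [dotProduct, ← Finset.sum_add_distrib]
    refine Finset.sum_le_sum fun i _ => ?_
    have h1 := mul_le_mul_of_nonneg_left (hξ i).1 (hα i).1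
    have h2 := mul_le_mul_of_nonneg_right (hα i).2 (hξ i).2
    linarith
  rw [dotProduct_mulVec_eq_neg hM hu] at hle
  rw [boxDual_eq hM hu]
  linarith

/-- First-order optimality condition for the dual problem over a box. -/
theorem boxDual_variational (hM : M.PosDef) {c α : m → ℝ} (hα : ∀ i, 0 ≤ α i ∧ α i ≤ c i)
    (hopt : ∀ β : m → ℝ, (∀ i, 0 ≤ β i ∧ β i ≤ c i) → boxDual M H β ≤ boxDual M H α)
    {u : k → ℝ} (hu : u = -(M⁻¹ *ᵥ (Hᵀ *ᵥ α)))
    {β : m → ℝ} (hβ : ∀ i, 0 ≤ β i ∧ β i ≤ c i) :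
    (fun _ : m => (1 : ℝ)) ⬝ᵥ (β - α) + (β - α) ⬝ᵥ H *ᵥ u ≤ 0 := by
  obtain ⟨v, hv⟩ : ∃ v, v = -(M⁻¹ *ᵥ (Hᵀ *ᵥ (β - α))) := ⟨_, rfl⟩
  have hsymm : Mᵀ = M := by simpa using hM.isHermitian.eq
  refine nonpos_of_forall_mul_le_sq (b := (1 / 2) * (v ⬝ᵥ M *ᵥ v)) fun t ht0 ht1 => ?_
  have hbox : ∀ i, 0 ≤ (α + t • (β - α)) i ∧ (α + t • (β - α)) i ≤ c i := by
    intro i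
    obtain ⟨ha, ha'⟩ := hα i
    obtain ⟨hb, hb'⟩ := hβ i
    simp only [Pi.add_apply, Pi.smul_apply, Pi.sub_apply, smul_eq_mul]
    constructor <;> nlinarith
  have hw : u + t • v = -(M⁻¹ *ᵥ (Hᵀ *ᵥ (α + t • (β - α)))) := by
    rw [hu, hv]
    simp only [mulVec_add, mulVec_smul, neg_add, smul_neg]
  have key := hopt _ hbox
  rw [boxDual_eq hM hw, boxDual_eq hM hu] at key
  rw [dotProduct_mulVec_eq_neg hM hv]
  simp only [mulVec_add, mulVec_smul, dotProduct_add, add_dotProduct, smul_dotProduct,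
    dotProduct_smul, smul_eq_mul, dotProduct_mulVec_comm hsymm v u] at key
  linarith

/-- Strong duality: the slacks `max 0 (1 + H u)` attain the dual optimum. -/
theorem primal_eq_boxDual (hM : M.PosDef) {c α : m → ℝ} (hα : ∀ i, 0 ≤ α i ∧ α i ≤ c i)
    (hopt : ∀ β : m → ℝ, (∀ i, 0 ≤ β i ∧ β i ≤ c i) → boxDual M H β ≤ boxDual M H α)
    {u : k → ℝ} (hu : u = -(M⁻¹ *ᵥ (Hᵀ *ᵥ α))) :
    (1 / 2) * (u ⬝ᵥ M *ᵥ u) + c ⬝ᵥ (fun i => max 0 (1 + (H *ᵥ u) i)) = boxDual M H α := by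
  refine le_antisymm ?_ (boxDual_le hM hα fun i => ⟨le_max_right _ _, le_max_left _ _⟩)
  classical
  have hβ : ∀ i, 0 ≤ (if 0 ≤ 1 + (H *ᵥ u) i then c i else 0) ∧
      (if 0 ≤ 1 + (H *ᵥ u) i then c i else 0) ≤ c i := by
    intro i
    have hc : 0 ≤ c i := (hα i).1.trans (hα i).2
    split_ifs <;> simp [hc]
  have key := boxDual_variational hM hα hopt hu hβ
  have hsum : c ⬝ᵥ (fun i => max 0 (1 + (H *ᵥ u) i)) =
      (fun _ : m => (1 : ℝ)) ⬝ᵥ (fun i => if 0 ≤ 1 + (H *ᵥ u) i then c i else 0) +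
        (fun i => if 0 ≤ 1 + (H *ᵥ u) i then c i else 0) ⬝ᵥ H *ᵥ u := by
    simp only [dotProduct, ← Finset.sum_add_distrib]
    refine Finset.sum_congr rfl fun i _ => ?_
    split_ifs with h
    · rw [max_eq_right h]; ring
    · rw [max_eq_left (not_le.1 h).le]; ring
  have hα' := dotProduct_mulVec_eq_neg hM hu u
  rw [dotProduct_sub, sub_dotProduct] at key
  rw [boxDual_eq hM hu, hsum]
  linarith

end BoxDual

section Augmented

variable {n l : ℕ}

/-- Multiplying by a matrix with an appended column of ones. -/
theorem of_snoc_one_mulVec (X : Matrix (Fin l) (Fin n) ℝ) (u : Fin (n + 1) → ℝ) :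
    (Matrix.of fun i => (Fin.snoc (X i) 1 : Fin (n + 1) → ℝ)) *ᵥ u =
      X *ᵥ Fin.init u + u (Fin.last n) • (fun _ : Fin l => (1 : ℝ)) := by
  ext i
  simp [mulVec, dotProduct, Fin.sum_univ_castSucc, Fin.init]

/-- The quadratic form of the regularized Gram matrix `HᵀH + cE₁`. -/
theorem dotProduct_regularizedGram_mulVec (X : Matrix (Fin l) (Fin n) ℝ) (c : ℝ)
    (u : Fin (n + 1) → ℝ) :
    u ⬝ᵥ ((Matrix.of fun i => (Fin.snoc (X i) 1 : Fin (n + 1) → ℝ))ᵀ *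
        (Matrix.of fun i => (Fin.snoc (X i) 1 : Fin (n + 1) → ℝ)) +
        c • Matrix.diagonal (Fin.snoc (fun _ : Fin n => (1 : ℝ)) 0)) *ᵥ u =
      c * (Fin.init u ⬝ᵥ Fin.init u) +
        (X *ᵥ Fin.init u + u (Fin.last n) • (fun _ : Fin l => (1 : ℝ))) ⬝ᵥ
          (X *ᵥ Fin.init u + u (Fin.last n) • (fun _ : Fin l => (1 : ℝ))) := by
  have hdiag : u ⬝ᵥ (Matrix.diagonal (Fin.snoc (fun _ : Fin n => (1 : ℝ)) 0)) *ᵥ u =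
      Fin.init u ⬝ᵥ Fin.init u := by
    simp [dotProduct, mulVec_diagonal, Fin.sum_univ_castSucc, Fin.init]
  rw [add_mulVec, dotProduct_add, smul_mulVec, dotProduct_smul, hdiag, ← mulVec_mulVec,
    dotProduct_mulVec, vecMul_transpose, of_snoc_one_mulVec, smul_eq_mul, add_comm]

theorem posDef_regularizedGram (hl : 1 ≤ l) (X : Matrix (Fin l) (Fin n) ℝ) {c : ℝ}
    (hc : 0 < c) :
    ((Matrix.of fun i => (Fin.snoc (X i) 1 : Fin (n + 1) → ℝ))ᵀ *
        (Matrix.of fun i => (Fin.snoc (X i) 1 : Fin (n + 1) → ℝ)) +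
        c • Matrix.diagonal (Fin.snoc (fun _ : Fin n => (1 : ℝ)) 0)).PosDef := by
  refine PosDef.of_dotProduct_mulVec_pos ?_ fun u hu => ?_
  · simp [IsHermitian, conjTranspose_eq_transpose_of_trivial, transpose_add, transpose_mul]
  rw [star_trivial, dotProduct_regularizedGram_mulVec]
  have h1 : 0 ≤ Fin.init u ⬝ᵥ Fin.init u := Finset.sum_nonneg fun i _ => mul_self_nonneg _
  have h2 : 0 ≤ (X *ᵥ Fin.init u + u (Fin.last n) • (fun _ : Fin l => (1 : ℝ))) ⬝ᵥ
      (X *ᵥ Fin.init u + u (Fin.last n) • (fun _ : Fin l => (1 : ℝ))) :=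
    Finset.sum_nonneg fun i _ => mul_self_nonneg _
  rcases h1.eq_or_lt with h | h
  · have hinit : (Fin.init u : Fin n → ℝ) = 0 := dotProduct_self_eq_zero.1 h.symm
    refine add_pos_of_nonneg_of_pos (mul_nonneg hc.le h1) (h2.lt_of_ne' fun h0 => hu ?_)
    have h3 := congrFun (dotProduct_self_eq_zero.1 h0) ⟨0, hl⟩
    have hlast : u (Fin.last n) = 0 := by simpa [hinit] using h3
    ext i
    refine Fin.lastCases hlast (fun j => ?_) i
    exact congrFun hinit j
  · exact add_pos_of_pos_of_nonneg (mul_pos hc h) h2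

end Augmented

/-- Theorem 1, first problem: if `α*` maximizes the dual objective over the box
`0 ≤ α ≤ c₃s₋`, then `u* = (w*, b*) = -M⁻¹H₋ᵀα*` together with
`ξ*ᵢ = max(0, 1 + (X₋w* + e₋b*)ᵢ)` is feasible and optimal for the primal problem, and the
optimal primal and dual values coincide. -/
theorem frtsvm_primal_recovery {n lp lm : ℕ} (hlp : 1 ≤ lp) (hlm : 1 ≤ lm)
    (Xp : Matrix (Fin lp) (Fin n) ℝ) (Xm : Matrix (Fin lm) (Fin n) ℝ)
    (c₁ c₃ : ℝ) (hc₁ : 0 < c₁) (hc₃ : 0 < c₃)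
    (s : Fin lm → ℝ) (hs : ∀ i, 0 < s i) :
    let Hp : Matrix (Fin lp) (Fin (n + 1)) ℝ := Matrix.of fun i => Fin.snoc (Xp i) 1
    let Hm : Matrix (Fin lm) (Fin (n + 1)) ℝ := Matrix.of fun i => Fin.snoc (Xm i) 1
    let E₁ : Matrix (Fin (n + 1)) (Fin (n + 1)) ℝ :=
      Matrix.diagonal (Fin.snoc (fun _ : Fin n => (1 : ℝ)) 0)
    let M := Hpᵀ * Hp + c₁ • E₁
    let dual : (Fin lm → ℝ) → ℝ := fun α =>
      (fun _ : Fin lm => (1 : ℝ)) ⬝ᵥ α - (1 / 2) * (α ⬝ᵥ (Hm * M⁻¹ * Hmᵀ) *ᵥ α)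
    let primal : (Fin n → ℝ) → ℝ → (Fin lm → ℝ) → ℝ := fun w b ξ =>
      (1 / 2) * c₁ * (w ⬝ᵥ w)
        + (1 / 2) * ((Xp *ᵥ w + b • (fun _ : Fin lp => (1 : ℝ)))
            ⬝ᵥ (Xp *ᵥ w + b • (fun _ : Fin lp => (1 : ℝ))))
        + c₃ * (s ⬝ᵥ ξ)
    ∀ αs : Fin lm → ℝ,
      (∀ i, 0 ≤ αs i ∧ αs i ≤ c₃ * s i) →
      (∀ α : Fin lm → ℝ, (∀ i, 0 ≤ α i ∧ α i ≤ c₃ * s i) → dual α ≤ dual αs) →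
      let ustar : Fin (n + 1) → ℝ := -(M⁻¹ *ᵥ (Hmᵀ *ᵥ αs))
      let wstar : Fin n → ℝ := Fin.init ustar
      let bstar : ℝ := ustar (Fin.last n)
      let ξstar : Fin lm → ℝ := fun i => max 0 (1 + ((Xm *ᵥ wstar) i + bstar))
      (∀ i, -((Xm *ᵥ wstar) i + bstar) + ξstar i ≥ 1 ∧ 0 ≤ ξstar i) ∧
      (∀ (w : Fin n → ℝ) (b : ℝ) (ξ : Fin lm → ℝ),
          (∀ i, -((Xm *ᵥ w) i + b) + ξ i ≥ 1 ∧ 0 ≤ ξ i) →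
          primal wstar bstar ξstar ≤ primal w b ξ) ∧
      primal wstar bstar ξstar = dual αs := by
  intro Hp Hm E₁ M dual primal αs hα hopt ustar wstar bstar ξstar
  have hM : M.PosDef := posDef_regularizedGram hlp Xp hc₁
  have hprimal : ∀ (u : Fin (n + 1) → ℝ) (ξ : Fin lm → ℝ),
      primal (Fin.init u) (u (Fin.last n)) ξ =
        (1 / 2) * (u ⬝ᵥ M *ᵥ u) + (fun i => c₃ * s i) ⬝ᵥ ξ := by
    intro u ξ
    have hs' : (fun i => c₃ * s i) ⬝ᵥ ξ = c₃ * (s ⬝ᵥ ξ) := smul_dotProduct c₃ s ξ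
    have hq : u ⬝ᵥ M *ᵥ u = _ := dotProduct_regularizedGram_mulVec Xp c₁ u
    rw [hq, hs']
    simp only [primal]
    ring
  have hHm : ∀ (u : Fin (n + 1) → ℝ) (i : Fin lm),
      (Hm *ᵥ u) i = (Xm *ᵥ Fin.init u) i + u (Fin.last n) := by
    intro u i
    have h := congrFun (of_snoc_one_mulVec Xm u) i
    simpa using h
  have hstrong : primal wstar bstar ξstar = dual αs := by
    have h := primal_eq_boxDual (H := Hm) hM hα hopt (u := ustar) rfl
    simp only [hHm] at h
    exact (hprimal ustar ξstar).trans h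
  refine ⟨fun i => ⟨?_, le_max_left _ _⟩, fun w b ξ hξ => ?_, hstrong⟩
  · have h : 1 + ((Xm *ᵥ wstar) i + bstar) ≤ ξstar i := le_max_right _ _
    linarith
  · have hp := hprimal (Fin.snoc w b) ξ
    rw [Fin.init_snoc, Fin.snoc_last] at hp
    rw [hstrong, hp]
    refine boxDual_le (H := Hm) hM hα fun i => ⟨?_, (hξ i).2⟩
    rw [hHm, Fin.init_snoc, Fin.snoc_last]
    linarith [(hξ i).1]
end

section
/- (Theorem 3(a).) Suppose the coordinate descent sequence {α^{k,i}} converges to a point α* (i.e., α^{k,i} → α* as k → ∞, for every inner index i). If α*ᵢ = 0 and ∇ᵢf(α*) > 0 for some coordinate i, then there exists kᵢ such that for all k ≥ kᵢ and all inner indices r ∈ {1, …, l+1}, the i-th coordinate of α^{k,r} equals 0. -/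
open Matrix

/-- Theorem 3(a): if the coordinate descent sequence `{α^{k,i}}` converges to `α*`, and at
some coordinate `i` we have `α*ᵢ = 0` and `∇ᵢf(α*) > 0`, then from some outer iteration `kᵢ`
onward the `i`-th coordinate of every iterate equals `0`. -/
theorem cd_shrinking_lower_bound {l : ℕ} (Q : Matrix (Fin l) (Fin l) ℝ)
    (hQ : Q.PosSemidef) (hQd : ∀ i, 0 < Q i i)
    (e c : Fin l → ℝ) (hc : ∀ i, 0 < c i)
    (A : ℕ → Fin (l + 1) → Fin l → ℝ)
    (hinit : ∀ j, 0 ≤ A 0 0 j ∧ A 0 0 j ≤ c j)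
    (hstep : ∀ (k : ℕ) (i : Fin l),
      (∀ j, j ≠ i → A k i.succ j = A k i.castSucc j) ∧
      A k i.succ i
        = min (max (A k i.castSucc i - ((Q *ᵥ A k i.castSucc - e) i) / Q i i) 0) (c i))
    (hwrap : ∀ k, A (k + 1) 0 = A k (Fin.last l))
    (αs : Fin l → ℝ)
    (hconv : ∀ i : Fin (l + 1), Filter.Tendsto (fun k => A k i) Filter.atTop (nhds αs))
    (i : Fin l) (hzero : αs i = 0) (hgrad : 0 < (Q *ᵥ αs - e) i) :
    ∃ K : ℕ, ∀ k ≥ K, ∀ r : Fin (l + 1), A k r i = 0 := by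
  have hcont : Filter.Tendsto
      (fun k => A k i.castSucc i - ((Q *ᵥ A k i.castSucc - e) i) / Q i i) Filter.atTop
      (nhds (αs i - ((Q *ᵥ αs - e) i) / Q i i)) := by
    have hg : Continuous fun x : Fin l → ℝ => x i - ((Q *ᵥ x - e) i) / Q i i := by
      simp only [Pi.sub_apply, Matrix.mulVec, dotProduct]
      fun_prop
    exact (hg.tendsto αs).comp (hconv i.castSucc)
  have hneg : αs i - ((Q *ᵥ αs - e) i) / Q i i < 0 := by
    have := div_pos hgrad (hQd i)
    linarith
  obtain ⟨K, hK⟩ := Filter.eventually_atTop.1 (hcont.eventually (gt_mem_nhds hneg))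
  have hupdate : ∀ k ≥ K, A k i.succ i = 0 := fun k hk => by
    rw [(hstep k i).2, max_eq_right (hK k hk).le, min_eq_left (hc i).le]
  have hafter : ∀ k ≥ K, ∀ r : Fin (l + 1), i.castSucc < r → A k r i = 0 := fun k hk r => by
    induction r using Fin.induction with
    | zero => exact fun h => absurd h (Fin.not_lt_zero _)
    | succ j ih =>
      intro h
      by_cases hij : i = j
      · exact hij ▸ hupdate k hk
      · rw [(hstep k j).1 i hij]
        exact ih (Fin.castSucc_lt_castSucc_iff.2
          (lt_of_le_of_ne (Fin.castSucc_lt_succ_iff.1 h) hij))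
  refine ⟨K + 1, fun k hk r => ?_⟩
  induction r using Fin.induction with
  | zero =>
    obtain ⟨m, rfl⟩ : ∃ m, k = m + 1 := ⟨k - 1, by omega⟩
    rw [hwrap]
    exact hafter m (by omega) _ (Fin.castSucc_lt_last i)
  | succ j ih =>
    by_cases hij : i = j
    · exact hij ▸ hupdate k (by omega)
    · rw [(hstep k j).1 i hij, ih]
end

section
/- (Theorem 3(b).) Suppose the coordinate descent sequence {α^{k,i}} converges to a point α* (i.e., α^{k,i} → α* as k → ∞, for every inner index i). If α*ᵢ = cᵢ and ∇ᵢf(α*) < 0 for some coordinate i, then there exists kᵢ such that for all k ≥ kᵢ and all inner indices r ∈ {1, …, l+1}, the i-th coordinate of α^{k,r} equals cᵢ. -/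
open Matrix

/-- Theorem 3(b): if the coordinate descent sequence `{α^{k,i}}` converges to `α*`, and at
some coordinate `i` we have `α*ᵢ = cᵢ` and `∇ᵢf(α*) < 0`, then from some outer iteration `kᵢ`
onward the `i`-th coordinate of every iterate equals `cᵢ`. -/
theorem cd_shrinking_upper_bound {l : ℕ} (Q : Matrix (Fin l) (Fin l) ℝ)
    (hQ : Q.PosSemidef) (hQd : ∀ i, 0 < Q i i)
    (e c : Fin l → ℝ) (hc : ∀ i, 0 < c i)
    (A : ℕ → Fin (l + 1) → Fin l → ℝ)
    (hinit : ∀ j, 0 ≤ A 0 0 j ∧ A 0 0 j ≤ c j)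
    (hstep : ∀ (k : ℕ) (i : Fin l),
      (∀ j, j ≠ i → A k i.succ j = A k i.castSucc j) ∧
      A k i.succ i
        = min (max (A k i.castSucc i - ((Q *ᵥ A k i.castSucc - e) i) / Q i i) 0) (c i))
    (hwrap : ∀ k, A (k + 1) 0 = A k (Fin.last l))
    (αs : Fin l → ℝ)
    (hconv : ∀ i : Fin (l + 1), Filter.Tendsto (fun k => A k i) Filter.atTop (nhds αs))
    (i : Fin l) (hbound : αs i = c i) (hgrad : (Q *ᵥ αs - e) i < 0) :
    ∃ K : ℕ, ∀ k ≥ K, ∀ r : Fin (l + 1), A k r i = c i := by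
  have hlim : Filter.Tendsto
      (fun k => A k i.castSucc i - ((Q *ᵥ A k i.castSucc - e) i) / Q i i) Filter.atTop
      (nhds (αs i - ((Q *ᵥ αs - e) i) / Q i i)) := by
    have hcont : Continuous (fun x : Fin l → ℝ => x i - ((Q *ᵥ x - e) i) / Q i i) := by
      have h : Continuous (fun x : Fin l → ℝ => Q *ᵥ x - e) := by fun_prop
      exact (continuous_apply i).sub (((continuous_apply i).comp h).div_const _)
    exact (hcont.tendsto αs).comp (hconv i.castSucc)
  have hgt : c i < αs i - ((Q *ᵥ αs - e) i) / Q i i := by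
    have := div_neg_of_neg_of_pos hgrad (hQd i)
    linarith
  obtain ⟨K, hK⟩ := Filter.eventually_atTop.mp (hlim.eventually (lt_mem_nhds hgt))
  have hupdate : ∀ k ≥ K, A k i.succ i = c i := fun k hk => by
    rw [(hstep k i).2]
    exact min_eq_right ((hK k hk).le.trans (le_max_left _ _))
  have hkeep : ∀ k ≥ K, ∀ j : Fin l, A k j.castSucc i = c i → A k j.succ i = c i := by
    intro k hk j hj
    rcases eq_or_ne i j with rfl | hij
    · exact hupdate k hk
    · rw [(hstep k j).1 i hij, hj]
  have hafter : ∀ k ≥ K, ∀ r : Fin (l + 1), i.succ ≤ r → A k r i = c i := by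
    intro k hk r
    induction r using Fin.induction with
    | zero => intro h; simp at h
    | succ j ih =>
      intro h
      rcases (Fin.succ_le_succ_iff.mp h).eq_or_lt with rfl | hij
      · exact hupdate k hk
      · exact hkeep k hk j (ih (Fin.succ_le_castSucc_iff.mpr hij))
  refine ⟨K + 1, fun k hk r => ?_⟩
  obtain ⟨m, rfl⟩ : ∃ m, k = m + 1 := ⟨k - 1, by omega⟩
  induction r using Fin.induction with
  | zero => rw [hwrap]; exact hafter m (by omega) _ (Fin.le_last _)
  | succ j ih => exact hkeep _ (by omega) j ih
end

section
/- (Theorem 3(c).) Suppose the coordinate descent sequence {α^{k,i}} converges to a minimizer α* of f over the box {α : 0 ≤ α ≤ c} (i.e., α^{k,i} → α* as k → ∞, for every inner index i). Then both the maximal and the minimal projected gradients along the sweep tend to zero: lim_{k→∞} max_{1≤i≤l} ∇ᵢᵖf(α^{k,i}) = 0 and lim_{k→∞} min_{1≤i≤l} ∇ᵢᵖf(α^{k,i}) = 0. -/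
open Matrix

open Filter Topology

/-- The projected gradient vanishes along a one-dimensional projected gradient iteration
`x (k + 1) = proj_{[0, c]} (x k - g k / q)` whose iterates and gradients both converge. -/
theorem tendsto_projGrad_of_clipped_step {x g : ℕ → ℝ} {a b c q : ℝ} (hq : 0 < q) (hc : 0 < c)
    (hx : Tendsto x atTop (𝓝 a)) (hg : Tendsto g atTop (𝓝 b))
    (hstep : ∀ k, x (k + 1) = min (max (x k - g k / q) 0) c) :
    Tendsto (fun k => if x k = 0 then min 0 (g k) else if x k = c then max 0 (g k) else g k)
      atTop (𝓝 0) := by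
  have hs : Tendsto (fun k => x k - g k / q) atTop (𝓝 (a - b / q)) := hx.sub (hg.div_const q)
  have hfix : a = min (max (a - b / q) 0) c := by
    refine tendsto_nhds_unique ((tendsto_add_atTop_iff_nat 1).2 hx) ?_
    simp only [hstep]
    exact (hs.max tendsto_const_nhds).min tendsto_const_nhds
  rcases lt_trichotomy b 0 with hb | rfl | hb
  · have hbq : b / q < 0 := div_neg_of_neg_of_pos hb hq
    have hac : c < a - b / q := by grind
    refine (tendsto_add_atTop_iff_nat 1).1 (tendsto_const_nhds.congr' ?_)
    filter_upwards [hs.eventually_const_lt hac,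
      ((tendsto_add_atTop_iff_nat 1).2 hg).eventually_lt_const hb] with k hk hgk
    have hxk : x (k + 1) = c := by rw [hstep]; grind
    grind
  · refine squeeze_zero_norm (fun k => ?_) (by simpa using hg.norm)
    simp only [Real.norm_eq_abs]
    grind
  · have hbq : 0 < b / q := div_pos hb hq
    have hac : a - b / q < 0 := by grind
    refine (tendsto_add_atTop_iff_nat 1).1 (tendsto_const_nhds.congr' ?_)
    filter_upwards [hs.eventually_lt_const hac,
      ((tendsto_add_atTop_iff_nat 1).2 hg).eventually_const_lt hb] with k hk hgk
    have hxk : x (k + 1) = 0 := by rw [hstep]; grind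
    grind

/-- In a cyclic sweep that changes only coordinate `i` at step `i`, coordinate `i` keeps its
updated value until step `i` of the next sweep. -/
theorem cyclic_sweep_coord_eq {l : ℕ} {R : Type*} {A : ℕ → Fin (l + 1) → Fin l → R}
    (hstep : ∀ (k : ℕ) (i j : Fin l), j ≠ i → A k i.succ j = A k i.castSucc j)
    (hwrap : ∀ k, A (k + 1) 0 = A k (Fin.last l)) (k : ℕ) (i : Fin l) :
    A (k + 1) i.castSucc i = A k i.succ i := by
  have hbefore : ∀ j : Fin (l + 1), j ≤ i.castSucc → A (k + 1) j i = A (k + 1) 0 i := by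
    intro j
    induction j using Fin.induction with
    | zero => intro _; rfl
    | succ j ih =>
      intro hj
      have hji : j < i := Fin.castSucc_lt_castSucc_iff.1 ((Fin.castSucc_lt_succ).trans_le hj)
      rw [hstep _ _ _ hji.ne', ih (Fin.castSucc_le_castSucc_iff.2 hji.le)]
  have hafter : ∀ j : Fin (l + 1), i.succ ≤ j → A k j i = A k i.succ i := by
    intro j
    induction j using Fin.induction with
    | zero => intro hj; simp at hj
    | succ j ih =>
      intro hj
      rcases (Fin.succ_le_succ_iff.1 hj).eq_or_lt with rfl | hij
      · rfl
      · rw [hstep _ _ _ hij.ne, ih (Fin.succ_le_castSucc_iff.2 hij)]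
  rw [hbefore _ le_rfl, hwrap, hafter _ (Fin.le_last _)]

/-- Theorem 3(c): if the coordinate descent sequence `{α^{k,i}}` converges to a minimizer `α*`
of `f` over the box `{α : 0 ≤ α ≤ c}`, then both the maximal and the minimal projected
gradients along each sweep tend to zero as `k → ∞`. -/
theorem cd_projGrad_tendsto_zero {l : ℕ} (hl : 0 < l) (Q : Matrix (Fin l) (Fin l) ℝ)
    (hQ : Q.PosSemidef) (hQd : ∀ i, 0 < Q i i)
    (e c : Fin l → ℝ) (hc : ∀ i, 0 < c i)
    (A : ℕ → Fin (l + 1) → Fin l → ℝ)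
    (hinit : ∀ j, 0 ≤ A 0 0 j ∧ A 0 0 j ≤ c j)
    (hstep : ∀ (k : ℕ) (i : Fin l),
      (∀ j, j ≠ i → A k i.succ j = A k i.castSucc j) ∧
      A k i.succ i
        = min (max (A k i.castSucc i - ((Q *ᵥ A k i.castSucc - e) i) / Q i i) 0) (c i))
    (hwrap : ∀ k, A (k + 1) 0 = A k (Fin.last l))
    (αs : Fin l → ℝ) (hαs : ∀ i, 0 ≤ αs i ∧ αs i ≤ c i)
    (hmin : ∀ α : Fin l → ℝ, (∀ i, 0 ≤ α i ∧ α i ≤ c i) →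
      (1 / 2) * (αs ⬝ᵥ Q *ᵥ αs) - e ⬝ᵥ αs ≤ (1 / 2) * (α ⬝ᵥ Q *ᵥ α) - e ⬝ᵥ α)
    (hconv : ∀ i : Fin (l + 1), Filter.Tendsto (fun k => A k i) Filter.atTop (nhds αs)) :
    let pg : (Fin l → ℝ) → Fin l → ℝ := fun x i =>
      if x i = 0 then min 0 ((Q *ᵥ x - e) i)
      else if x i = c i then max 0 ((Q *ᵥ x - e) i)
      else (Q *ᵥ x - e) i
    Filter.Tendsto
      (fun k => Finset.univ.sup'
        (Finset.univ_nonempty_iff.mpr (Fin.pos_iff_nonempty.mp hl))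
        (fun i : Fin l => pg (A k i.castSucc) i))
      Filter.atTop (nhds 0) ∧
    Filter.Tendsto
      (fun k => Finset.univ.inf'
        (Finset.univ_nonempty_iff.mpr (Fin.pos_iff_nonempty.mp hl))
        (fun i : Fin l => pg (A k i.castSucc) i))
      Filter.atTop (nhds 0) := by
  intro pg
  have hpg : ∀ i, Tendsto (fun k => pg (A k i.castSucc) i) atTop (𝓝 0) := by
    intro i
    have hgrad : Continuous fun x : Fin l → ℝ => (Q *ᵥ x - e) i := by fun_prop
    refine tendsto_projGrad_of_clipped_step (hQd i) (hc i)
      ((continuous_apply i).continuousAt.tendsto.comp (hconv i.castSucc))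
      (hgrad.continuousAt.tendsto.comp (hconv i.castSucc)) fun k => ?_
    exact (cyclic_sweep_coord_eq (fun k i => (hstep k i).1) hwrap k i).trans (hstep k i).2
  have hne : (Finset.univ : Finset (Fin l)).Nonempty :=
    Finset.univ_nonempty_iff.mpr (Fin.pos_iff_nonempty.mp hl)
  constructor
  · simpa using Tendsto.finset_sup'_nhds_apply hne fun i _ => hpg i
  · simpa using Tendsto.finset_inf'_nhds_apply hne fun i _ => hpg i
end
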